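/- The set of unimodal probability measures on the unit circle is closed under weak convergence: if μ_n are unimodal probability measures on 𝕋 converging weakly to μ, then μ is unimodal. -/

import Mathlib

open MeasureTheory Real Filter
open scoped ENNReal

instance : Fact (0 < 2 * π) := ⟨by positivity⟩

/-- A probability measure on the circle `ℝ / 2πℤ` is unimodal with mode `φ` and antimode `ψ`
if it is `c δ_φ + f(θ) dθ` with `f ≥ 0` non-decreasing on `(ψ, φ)` and
non-increasing on `(φ, ψ + 2π)`. -/
def IsUnimodalCircle (μ : Measure (AddCircle (2 * π))) : Prop :=
  ∃ φ ψ : ℝ, ψ ≤ φ ∧ φ ≤ ψ + 2 * π ∧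
    ∃ c : ℝ≥0∞, ∃ f : ℝ → ℝ, (∀ x, 0 ≤ f x) ∧
      MonotoneOn f (Set.Ioo ψ φ) ∧ AntitoneOn f (Set.Ioo φ (ψ + 2 * π)) ∧
      μ = c • Measure.dirac ((φ : AddCircle (2 * π))) +
        Measure.map (fun x : ℝ => (x : AddCircle (2 * π)))
          ((volume.restrict (Set.Ioo ψ (ψ + 2 * π))).withDensity fun x => ENNReal.ofReal (f x))


lemma no_atom_aux (l : Measure ℝ) [IsFiniteMeasure l] (a b : ℝ)
    (H : ∀ u v w, a < u → u < v → v < w → w < b →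
      l (Set.Ioo u v) ≤ ENNReal.ofReal ((v - u) / (w - v)) * l (Set.Icc v w))
    (x : ℝ) (hx : x ∈ Set.Ioo a b) : l {x} = 0 := by
  obtain ⟨hax, hxb⟩ := hx
  set w := (x + b) / 2 with hw
  have hlim : Tendsto (fun e : ℝ => ENNReal.ofReal ((2 * e) / (w - x - e)) * l Set.univ)
      (nhdsWithin 0 (Set.Ioi 0)) (nhds (ENNReal.ofReal ((2 * 0) / (w - x - 0)) * l Set.univ)) := by
    apply ENNReal.Tendsto.mul_const _ (Or.inr (measure_ne_top _ _))
    apply ENNReal.tendsto_ofReal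
    apply tendsto_nhdsWithin_of_tendsto_nhds
    have : ContinuousAt (fun e : ℝ => (2 * e) / (w - x - e)) 0 := by
      apply ContinuousAt.div (by fun_prop) (by fun_prop)
      simp only [sub_zero]
      linarith
    exact this
  simp only [mul_zero, zero_div, ENNReal.ofReal_zero, zero_mul] at hlim
  refine le_antisymm (ge_of_tendsto hlim ?_) bot_le
  have h1 : Set.Ioo 0 (min (x - a) ((w - x) / 2)) ∈ nhdsWithin (0 : ℝ) (Set.Ioi 0) := by
    apply Ioo_mem_nhdsGT
    apply lt_min <;> linarith
  filter_upwards [h1] with e he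
  obtain ⟨he0, he1⟩ := he
  have he2 := lt_of_lt_of_le he1 (min_le_left _ _)
  have he3 := lt_of_lt_of_le he1 (min_le_right _ _)
  calc l {x} ≤ l (Set.Ioo (x - e) (x + e)) := by
        apply measure_mono
        rintro y rfl
        constructor <;> linarith
    _ ≤ ENNReal.ofReal (((x + e) - (x - e)) / (w - (x + e))) * l (Set.Icc (x + e) w) :=
        H _ _ _ (by linarith) (by linarith) (by linarith) (by linarith)
    _ ≤ _ := by
        rw [show (x + e) - (x - e) = 2 * e by ring, show w - (x + e) = w - x - e by ring]
        exact mul_le_mul_right (measure_mono (Set.subset_univ _)) _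

lemma mono_density (l : Measure ℝ) [IsFiniteMeasure l] (a b : ℝ)
    (H : ∀ u v w, a < u → u < v → v < w → w < b →
      l (Set.Ioo u v) ≤ ENNReal.ofReal ((v - u) / (w - v)) * l (Set.Icc v w)) :
    ∃ f : ℝ → ℝ, (∀ x, 0 ≤ f x) ∧ MonotoneOn f (Set.Ioo a b) ∧
      l.restrict (Set.Ioo a b) =
        (volume.restrict (Set.Ioo a b)).withDensity (fun x => ENNReal.ofReal (f x)) := by
  have hat := no_atom_aux l a b H
  set F : ℝ → ℝ := fun x => l.real (Set.Iic x) with hF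
  have hmono : Monotone F := fun x y hxy => measureReal_mono (Set.Iic_subset_Iic.2 hxy)
  have hdiff : ∀ x y, x ≤ y → F y - F x = l.real (Set.Ioc x y) := by
    intro x y hxy
    rw [← Set.Iic_sdiff_Iic, measureReal_sdiff (Set.Iic_subset_Iic.2 hxy) measurableSet_Iic]
  have hIoo : ∀ x y, y ∈ Set.Ioo a b → l.real (Set.Ioo x y) = l.real (Set.Ioc x y) := by
    intro x y hy
    apply measureReal_congr
    exact Ioo_ae_eq_Ioc' (hat y hy)
  have hIcc : ∀ x y, x ∈ Set.Ioo a b → l.real (Set.Icc x y) = l.real (Set.Ioc x y) := by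
    intro x y hy
    apply measureReal_congr
    exact (Ioc_ae_eq_Icc' (hat x hy)).symm
  have hconv : ConvexOn ℝ (Set.Ioo a b) F := by
    apply convexOn_of_slope_mono_adjacent (convex_Ioo a b)
    intro x y z hx hz hxy hyz
    have hy : y ∈ Set.Ioo a b := ⟨hx.1.trans hxy, hyz.trans hz.2⟩
    rw [hdiff x y hxy.le, hdiff y z hyz.le, ← hIoo x y hy, ← hIcc y z hy]
    have h := H x y z hx.1 hxy hyz hz.2
    have h0 : 0 ≤ (y - x) / (z - y) := div_nonneg (by linarith) (by linarith)
    have h2 := ENNReal.toReal_mono (by finiteness) h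
    rw [ENNReal.toReal_mul, ENNReal.toReal_ofReal h0] at h2
    change l.real _ ≤ _ * l.real _ at h2
    rw [div_le_iff₀ (by linarith)]
    calc _ ≤ _ := h2
      _ = _ := by field_simp
  have hcont : ContinuousOn F (Set.Ioo a b) := hconv.continuousOn isOpen_Ioo
  set g : ℝ → ℝ := fun x => derivWithin F (Set.Ioi x) x with hg
  have hgm : MonotoneOn g (Set.Ioo a b) := by
    have := hconv.monotoneOn_rightDeriv
    rwa [interior_Ioo] at this
  have hg0 : ∀ x, 0 ≤ g x := fun x => (hmono.monotoneOn _).derivWithin_nonneg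
  refine ⟨g, hg0, hgm, ?_⟩
  have hFTC : ∀ u v, a < u → v < b → u ≤ v →
      l (Set.Ioc u v) = ∫⁻ x in Set.Ioc u v, ENNReal.ofReal (g x) := by
    intro u v hu hv huv
    have hsub : Set.Icc u v ⊆ Set.Ioo a b := fun x hx =>
      ⟨hu.trans_le hx.1, hx.2.trans_lt hv⟩
    have hii : IntervalIntegrable g volume u v := by
      apply MonotoneOn.intervalIntegrable
      rw [Set.uIcc_of_le huv]
      exact hgm.mono hsub
    have := intervalIntegral.integral_eq_sub_of_hasDeriv_right_of_le huv (hcont.mono hsub)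
      (f' := g) (fun x hx => hconv.hasDerivWithinAt_rightDeriv_of_mem_interior
        (by rw [interior_Ioo]; exact hsub (Set.Ioo_subset_Icc_self hx))) hii
    rw [hdiff u v huv, intervalIntegral.integral_of_le huv] at this
    rw [← ofReal_integral_eq_lintegral_ofReal hii.1 (ae_of_all _ hg0), this, ofReal_measureReal]
  set ρ : Measure ℝ := volume.withDensity (fun x => ENNReal.ofReal (g x)) with hρ
  rw [← restrict_withDensity measurableSet_Ioo, ← hρ]
  have key : ∀ q : {q : ℚ × ℚ // a < q.1 ∧ (q.2 : ℝ) < b},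
      l.restrict (Set.Ioc (q.1.1 : ℝ) q.1.2) = ρ.restrict (Set.Ioc (q.1.1 : ℝ) q.1.2) := by
    rintro ⟨⟨c, d⟩, hc, hd⟩
    simp only at hc hd ⊢
    apply Measure.ext_of_Ioc
    intro u v huv
    rw [Measure.restrict_apply measurableSet_Ioc, Measure.restrict_apply measurableSet_Ioc,
      Set.Ioc_inter_Ioc, hρ, withDensity_apply _ measurableSet_Ioc]
    by_cases h : u ⊔ c ≤ v ⊓ d
    · exact hFTC _ _ (hc.trans_le le_sup_right) (inf_le_right.trans_lt hd) h
    · rw [Set.Ioc_eq_empty (fun h' => h h'.le)]; simp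
  have hU : Set.Ioo a b = ⋃ q : {q : ℚ × ℚ // a < q.1 ∧ (q.2 : ℝ) < b},
      Set.Ioc (q.1.1 : ℝ) q.1.2 := by
    ext x
    simp only [Set.mem_iUnion]
    constructor
    · rintro ⟨h1, h2⟩
      obtain ⟨c, hc1, hc2⟩ := exists_rat_btwn h1
      obtain ⟨d, hd1, hd2⟩ := exists_rat_btwn h2
      exact ⟨⟨(c, d), hc1, hd2⟩, hc2, hd1.le⟩
    · rintro ⟨⟨⟨c, d⟩, hc, hd⟩, h1, h2⟩
      exact ⟨hc.trans h1, lt_of_le_of_lt h2 hd⟩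
  rw [hU]
  exact Measure.restrict_iUnion_congr.2 key

lemma anti_density (l : Measure ℝ) [IsFiniteMeasure l] (a b : ℝ)
    (H : ∀ u v w, a < u → u < v → v < w → w < b →
      l (Set.Ioo v w) ≤ ENNReal.ofReal ((w - v) / (v - u)) * l (Set.Icc u v)) :
    ∃ f : ℝ → ℝ, (∀ x, 0 ≤ f x) ∧ AntitoneOn f (Set.Ioo a b) ∧
      l.restrict (Set.Ioo a b) =
        (volume.restrict (Set.Ioo a b)).withDensity (fun x => ENNReal.ofReal (f x)) := by
  set e : ℝ ≃ᵐ ℝ := MeasurableEquiv.neg ℝ with he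
  have hee : ∀ x, e x = -x := fun x => rfl
  have hpre : ∀ x y : ℝ, e ⁻¹' (Set.Ioo x y) = Set.Ioo (-y) (-x) := by
    intro x y; ext z; simp [hee]; constructor <;> rintro ⟨h1, h2⟩ <;> constructor <;> linarith
  have hpre2 : ∀ x y : ℝ, e ⁻¹' (Set.Icc x y) = Set.Icc (-y) (-x) := by
    intro x y; ext z; simp [hee]; constructor <;> rintro ⟨h1, h2⟩ <;> constructor <;> linarith
  obtain ⟨f, hf0, hfm, hfe⟩ := mono_density (l.map e) (-b) (-a) (by
    intro u v w hu huv hvw hw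
    rw [e.map_apply, e.map_apply, hpre, hpre2]
    have := H (-w) (-v) (-u) (by linarith) (by linarith) (by linarith) (by linarith)
    rwa [show -u - -v = v - u by ring, show -v - -w = w - v by ring] at this)
  refine ⟨fun x => f (-x), fun x => hf0 _, ?_, ?_⟩
  · intro x hx y hy hxy
    exact hfm ⟨by linarith [hy.2], by linarith [hy.1]⟩ ⟨by linarith [hx.2], by linarith [hx.1]⟩
      (by linarith)
  · ext s hs
    have h1 := DFunLike.congr_fun hfe (e ⁻¹' s)
    have hs' : MeasurableSet (e ⁻¹' s) := e.measurable hs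
    rw [Measure.restrict_apply hs', e.map_apply, withDensity_apply _ hs',
      Measure.restrict_restrict hs'] at h1
    rw [Measure.restrict_apply hs, withDensity_apply _ hs, Measure.restrict_restrict hs]
    have hset : e ⁻¹' (e ⁻¹' s ∩ Set.Ioo (-b) (-a)) = s ∩ Set.Ioo a b := by
      rw [Set.preimage_inter, hpre]
      simp only [neg_neg]
      congr 1
      ext z; simp [hee]
    rw [hset] at h1
    rw [h1, ← hset]
    have hmp : MeasurePreserving e (volume : Measure ℝ) volume :=
      Measure.measurePreserving_neg volume
    exact (hmp.setLIntegral_comp_preimage_emb e.measurableEmbedding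
      (fun x => ENNReal.ofReal (f x)) _).symm

/-- Shorthand for the quotient map to the circle. -/
noncomputable abbrev toC (x : ℝ) : AddCircle (2 * π) := (x : AddCircle (2 * π))

/-- Interval-average consequences of unimodality. -/
structure GoodCircle (μ : Measure (AddCircle (2 * π))) (φ ψ : ℝ) : Prop where
  mono : ∀ u v w, ψ ≤ u → u < v → v < w → w < φ →
    μ (toC '' Set.Ioo u v) ≤ ENNReal.ofReal ((v - u) / (w - v)) * μ (toC '' Set.Icc v w)
  anti : ∀ u v w, φ < u → u < v → v < w → w ≤ ψ + 2 * π →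
    μ (toC '' Set.Ioo v w) ≤ ENNReal.ofReal ((w - v) / (v - u)) * μ (toC '' Set.Icc u v)
  atom : ψ < φ → φ < ψ + 2 * π → μ {toC ψ} = 0

lemma toC_cont : Continuous toC := AddCircle.continuous_mk' (2 * π)

lemma toC_meas : Measurable toC := toC_cont.measurable

lemma toC_open (u v : ℝ) : IsOpen (toC '' Set.Ioo u v) :=
  QuotientAddGroup.isOpenMap_coe _ isOpen_Ioo

lemma toC_closed (u v : ℝ) : IsClosed (toC '' Set.Icc u v) :=
  (isCompact_Icc.image toC_cont).isClosed

lemma toC_inj {x y : ℝ} (h1 : x - y < 2 * π) (h2 : y - x < 2 * π) (h : toC x = toC y) : x = y := by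
  have hp := Real.pi_pos
  refine (AddCircle.coe_eq_coe_iff_of_mem_Ico (a := min x y) ?_ ?_).1 h
  · refine ⟨min_le_left _ _, ?_⟩
    rcases min_cases x y with h | h <;> linarith
  · refine ⟨min_le_right _ _, ?_⟩
    rcases min_cases x y with h | h <;> linarith

lemma toC_add_int (x : ℝ) (k : ℤ) : toC (x + k * (2 * π)) = toC x := by
  have h : ((k * (2 * π) : ℝ) : AddCircle (2 * π)) = 0 :=
    (AddCircle.coe_eq_zero_iff _).2 ⟨k, by simp⟩
  change ((x + k * (2 * π) : ℝ) : AddCircle (2 * π)) = x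
  rw [AddCircle.coe_add, h, add_zero]

lemma toC_add_period (x : ℝ) : toC (x + 2 * π) = toC x := by
  have := toC_add_int x 1
  simpa using this

lemma toC_image_Ioo (u v : ℝ) (k : ℤ) :
    toC '' Set.Ioo (u + k * (2 * π)) (v + k * (2 * π)) = toC '' Set.Ioo u v := by
  rw [← Set.image_add_const_Ioo, Set.image_image]
  simp only [toC_add_int]

lemma toC_image_Icc (u v : ℝ) (k : ℤ) :
    toC '' Set.Icc (u + k * (2 * π)) (v + k * (2 * π)) = toC '' Set.Icc u v := by
  rw [← Set.image_add_const_Icc, Set.image_image]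
  simp only [toC_add_int]

lemma GoodCircle.shift {μ : Measure (AddCircle (2 * π))} {φ ψ : ℝ} (h : GoodCircle μ φ ψ) (k : ℤ) :
    GoodCircle μ (φ + k * (2 * π)) (ψ + k * (2 * π)) := by
  obtain ⟨h1, h2, h3⟩ := h
  have e : ∀ x : ℝ, x = (x - k * (2 * π)) + k * (2 * π) := fun x => by ring
  refine ⟨?_, ?_, ?_⟩
  · intro u v w hu huv hvw hw
    have := h1 (u - k * (2 * π)) (v - k * (2 * π)) (w - k * (2 * π)) (by linarith) (by linarith)
      (by linarith) (by linarith)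
    rw [← toC_image_Ioo _ _ k, ← toC_image_Icc _ _ k] at this
    simpa using this
  · intro u v w hu huv hvw hw
    have := h2 (u - k * (2 * π)) (v - k * (2 * π)) (w - k * (2 * π)) (by linarith) (by linarith)
      (by linarith) (by linarith)
    rw [← toC_image_Ioo _ _ k, ← toC_image_Icc _ _ k] at this
    simpa using this
  · intro ha hb
    rw [toC_add_int]
    exact h3 (by linarith) (by linarith)

lemma IsUnimodalCircle.good {μ : Measure (AddCircle (2 * π))} (h : IsUnimodalCircle μ) :
    ∃ φ ψ : ℝ, ψ ≤ φ ∧ φ ≤ ψ + 2 * π ∧ GoodCircle μ φ ψ := by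
  obtain ⟨φ, ψ, h1, h2, c, f, hf0, hfm, hfa, rfl⟩ := h
  refine ⟨φ, ψ, h1, h2, ?_⟩
  set m : Measure (AddCircle (2 * π)) := Measure.map (fun x : ℝ => (x : AddCircle (2 * π)))
          ((volume.restrict (Set.Ioo ψ (ψ + 2 * π))).withDensity fun x => ENNReal.ofReal (f x))
    with hm
  have hmap : ∀ s, MeasurableSet s →
      m s = ∫⁻ x in toC ⁻¹' s ∩ Set.Ioo ψ (ψ + 2 * π), ENNReal.ofReal (f x) := by
    intro s hs
    rw [hm, Measure.map_apply toC_meas hs, withDensity_apply _ (toC_meas hs),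
      Measure.restrict_restrict (toC_meas hs)]
  have U : ∀ u v B, ψ ≤ u → v ≤ ψ + 2 * π → (v ≤ φ ∨ φ ≤ u) →
      (∀ x ∈ Set.Ioo u v, f x ≤ B) →
      (c • Measure.dirac ((φ : AddCircle (2 * π))) + m) (toC '' Set.Ioo u v) ≤
        ENNReal.ofReal B * ENNReal.ofReal (v - u) := by
    intro u v B hu hv hφ hB
    have hms := (toC_open u v).measurableSet
    have hn : (φ : AddCircle (2 * π)) ∉ toC '' Set.Ioo u v := by
      rintro ⟨x, hx, hxe⟩
      have : x = φ := toC_inj (by linarith [hx.2]) (by linarith [hx.1]) hxe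
      subst this
      rcases hφ with h | h
      · linarith [hx.2]
      · linarith [hx.1]
    rw [Measure.add_apply, Measure.smul_apply, Measure.dirac_apply' _ hms,
      Set.indicator_of_notMem hn, smul_zero, zero_add, hmap _ hms]
    calc _ ≤ ∫⁻ x in Set.Ioo u v, ENNReal.ofReal (f x) := by
          apply lintegral_mono_set
          rintro y ⟨⟨x, hx, hxe⟩, hy⟩
          have : x = y := toC_inj (by linarith [hx.2, hy.1]) (by linarith [hx.1, hy.2]) hxe
          exact this ▸ hx
      _ ≤ ∫⁻ x in Set.Ioo u v, ENNReal.ofReal B :=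
          setLIntegral_mono' measurableSet_Ioo fun x hx => ENNReal.ofReal_le_ofReal (hB x hx)
      _ = _ := by rw [setLIntegral_const, Real.volume_Ioo]
  have L : ∀ u v B, ψ < u → v < ψ + 2 * π → (∀ x ∈ Set.Icc u v, B ≤ f x) →
      ENNReal.ofReal B * ENNReal.ofReal (v - u) ≤
      (c • Measure.dirac ((φ : AddCircle (2 * π))) + m) (toC '' Set.Icc u v) := by
    intro u v B hu hv hB
    have hms := (toC_closed u v).measurableSet
    rw [Measure.add_apply]
    refine le_trans ?_ le_add_self
    rw [hmap _ hms]
    calc _ = ∫⁻ x in Set.Icc u v, ENNReal.ofReal B := by rw [setLIntegral_const, Real.volume_Icc]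
      _ ≤ ∫⁻ x in Set.Icc u v, ENNReal.ofReal (f x) :=
          setLIntegral_mono' measurableSet_Icc fun x hx => ENNReal.ofReal_le_ofReal (hB x hx)
      _ ≤ _ := by
          apply lintegral_mono_set
          intro x hx
          exact ⟨⟨x, hx, rfl⟩, by linarith [hx.1], by linarith [hx.2]⟩
  have alg : ∀ B p q : ℝ, 0 < p → 0 < q → ENNReal.ofReal B * ENNReal.ofReal p =
      ENNReal.ofReal (p / q) * (ENNReal.ofReal B * ENNReal.ofReal q) := by
    intro B p q hp hq
    have : p = p / q * q := by field_simp
    conv_lhs => rw [this]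
    rw [ENNReal.ofReal_mul (by positivity)]
    ring
  refine ⟨?_, ?_, ?_⟩
  · intro u v w hu huv hvw hw
    refine (U u v (f v) hu (by linarith) (Or.inl (by linarith)) ?_).trans ?_
    · intro x hx
      exact hfm ⟨by linarith [hx.1], by linarith [hx.2]⟩ ⟨by linarith, by linarith⟩ hx.2.le
    · rw [alg _ (v - u) (w - v) (by linarith) (by linarith)]
      refine mul_le_mul_right (L v w (f v) (by linarith) (by linarith) ?_) _
      intro x hx
      exact hfm ⟨by linarith, by linarith⟩ ⟨by linarith [hx.1], by linarith [hx.2]⟩ hx.1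
  · intro u v w hu huv hvw hw
    refine (U v w (f v) (by linarith) (by linarith) (Or.inr (by linarith)) ?_).trans ?_
    · intro x hx
      exact hfa ⟨by linarith, by linarith⟩ ⟨by linarith [hx.1], by linarith [hx.2]⟩ hx.1.le
    · rw [alg _ (w - v) (v - u) (by linarith) (by linarith)]
      refine mul_le_mul_right (L u v (f v) (by linarith) (by linarith) ?_) _
      intro x hx
      exact hfa ⟨by linarith [hx.1], by linarith [hx.2]⟩ ⟨by linarith, by linarith⟩ hx.2
  · intro ha hb
    have hms : MeasurableSet {toC ψ} := measurableSet_singleton _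
    have hn : (φ : AddCircle (2 * π)) ∉ ({toC ψ} : Set (AddCircle (2 * π))) := by
      intro hx
      have := toC_inj (x := φ) (y := ψ) (by linarith) (by linarith) hx
      linarith
    rw [Measure.add_apply, Measure.smul_apply, Measure.dirac_apply' _ hms,
      Set.indicator_of_notMem hn, smul_zero, zero_add, hmap _ hms]
    have : toC ⁻¹' {toC ψ} ∩ Set.Ioo ψ (ψ + 2 * π) = ∅ := by
      ext y
      simp only [Set.mem_inter_iff, Set.mem_empty_iff_false, iff_false]
      rintro ⟨hy, hy1, hy2⟩
      have := toC_inj (x := y) (y := ψ) (by linarith) (by linarith) hy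
      linarith
    rw [this]; simp

lemma IsUnimodalCircle.good_norm {μ : Measure (AddCircle (2 * π))} (h : IsUnimodalCircle μ) :
    ∃ p : ℝ × ℝ, p ∈ Set.Icc (0 : ℝ) (4 * π) ×ˢ Set.Icc (0 : ℝ) (2 * π) ∧
      p.2 ≤ p.1 ∧ p.1 ≤ p.2 + 2 * π ∧ GoodCircle μ p.1 p.2 := by
  have hp := Real.pi_pos
  obtain ⟨φ, ψ, h1, h2, hg⟩ := h.good
  obtain ⟨k, hk, -⟩ := existsUnique_add_zsmul_mem_Ico (show 0 < 2 * π by positivity) ψ 0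
  simp only [zsmul_eq_mul, zero_add] at hk
  exact ⟨(φ + k * (2 * π), ψ + k * (2 * π)),
    ⟨⟨by linarith [hk.1], by linarith [hk.2]⟩, ⟨hk.1, hk.2.le⟩⟩, by simpa using h1,
    by simp only; linarith, hg.shift k⟩

lemma limit_ineq {X : Type*} [MeasurableSpace X] [TopologicalSpace X] [OpensMeasurableSpace X]
    [HasOuterApproxClosed X] {μs : ℕ → ProbabilityMeasure X} {ν : ProbabilityMeasure X}
    (ht : Tendsto μs atTop (nhds ν)) {O C : Set X} (hO : IsOpen O) (hC : IsClosed C)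
    {K : ℝ≥0∞} (hK : K ≠ ⊤)
    (h : ∀ᶠ n in atTop, (μs n : Measure X) O ≤ K * (μs n : Measure X) C) :
    (ν : Measure X) O ≤ K * (ν : Measure X) C := by
  calc (ν : Measure X) O ≤ liminf (fun n => (μs n : Measure X) O) atTop :=
        ProbabilityMeasure.le_liminf_measure_open_of_tendsto ht hO
    _ ≤ liminf (fun n => K * (μs n : Measure X) C) atTop := liminf_le_liminf h
    _ ≤ limsup (fun n => K * (μs n : Measure X) C) atTop := liminf_le_limsup
    _ = K * limsup (fun n => (μs n : Measure X) C) atTop := ENNReal.limsup_const_mul_of_ne_top hK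
    _ ≤ _ := mul_le_mul_right (ProbabilityMeasure.limsup_measure_closed_le_of_tendsto ht hC) _

lemma limit_atom {μs : ℕ → ProbabilityMeasure (AddCircle (2 * π))}
    {ν : ProbabilityMeasure (AddCircle (2 * π))}
    (ht : Tendsto μs atTop (nhds ν)) {a b : ℕ → ℝ} {φ ψ : ℝ} (ha : Tendsto a atTop (nhds φ))
    (hb : Tendsto b atTop (nhds ψ)) (hg : ∀ n, GoodCircle (μs n : Measure _) (a n) (b n))
    (h1 : ψ < φ) (h2 : φ < ψ + 2 * π) : (ν : Measure (AddCircle (2 * π))) {toC ψ} = 0 := by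
  obtain ⟨d, hd0, hd1, hd2⟩ : ∃ d : ℝ, 0 < d ∧ 6 * d ≤ φ - ψ ∧ 6 * d ≤ ψ + 2 * π - φ := by
    refine ⟨min (φ - ψ) (ψ + 2 * π - φ) / 6, ?_, ?_, ?_⟩
    · have := lt_min (sub_pos.2 h1) (sub_pos.2 h2); linarith
    · have := min_le_left (φ - ψ) (ψ + 2 * π - φ); linarith
    · have := min_le_right (φ - ψ) (ψ + 2 * π - φ); linarith
  have hbound : ∀ e, 0 < e → e < d → (ν : Measure (AddCircle (2 * π))) {toC ψ} ≤
      ENNReal.ofReal (2 * e / d) + ENNReal.ofReal (2 * e / d) := by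
    intro e he0 hed
    have := limit_ineq ht (toC_open (ψ - e) (ψ + e)) isClosed_univ
      (K := ENNReal.ofReal (2 * e / d) + ENNReal.ofReal (2 * e / d)) (by finiteness) (by
        filter_upwards [ha (Ioo_mem_nhds (show φ - e < φ by linarith) (show φ < φ + e by linarith)),
          hb (Ioo_mem_nhds (show ψ - e < ψ by linarith) (show ψ < ψ + e by linarith))]
          with n han hbn
        obtain ⟨ha1, ha2⟩ := han
        obtain ⟨hb1, hb2⟩ := hbn
        have hsub : toC '' Set.Ioo (ψ - e) (ψ + e) ⊆
            (toC '' Set.Ioo (b n) (b n + 2 * e) ∪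
              toC '' Set.Ioo (b n + 2 * π - 2 * e) (b n + 2 * π)) ∪ {toC (b n)} := by
          rintro _ ⟨x, ⟨hx1, hx2⟩, rfl⟩
          rcases lt_trichotomy x (b n) with h | h | h
          · left; right
            exact ⟨x + 2 * π, ⟨by linarith, by linarith⟩, toC_add_period x⟩
          · right; rw [h]; rfl
          · left; left
            exact ⟨x, ⟨h, by linarith⟩, rfl⟩
        have hA := (hg n).atom (by linarith) (by linarith)
        have hB := (hg n).mono (b n) (b n + 2 * e) (b n + 2 * e + d) le_rfl (by linarith)
          (by linarith) (by linarith)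
        have hC := (hg n).anti (b n + 2 * π - 2 * e - d) (b n + 2 * π - 2 * e) (b n + 2 * π)
          (by linarith) (by linarith) (by linarith) le_rfl
        rw [show b n + 2 * e - b n = 2 * e by ring,
          show b n + 2 * e + d - (b n + 2 * e) = d by ring] at hB
        rw [show b n + 2 * π - (b n + 2 * π - 2 * e) = 2 * e by ring,
          show b n + 2 * π - 2 * e - (b n + 2 * π - 2 * e - d) = d by ring] at hC
        refine (measure_mono hsub).trans ((measure_union_le _ _).trans ?_)
        rw [hA, add_zero, add_mul]
        refine (measure_union_le _ _).trans (add_le_add (hB.trans ?_) (hC.trans ?_)) <;>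
        exact mul_le_mul_right (measure_mono (Set.subset_univ _)) _)
    rw [measure_univ, mul_one] at this
    refine (measure_mono ?_).trans this
    rintro _ rfl
    exact ⟨ψ, ⟨by linarith, by linarith⟩, rfl⟩
  have hlim : Tendsto (fun e : ℝ => ENNReal.ofReal (2 * e / d) + ENNReal.ofReal (2 * e / d))
      (nhdsWithin 0 (Set.Ioi 0)) (nhds (ENNReal.ofReal (2 * 0 / d) + ENNReal.ofReal (2 * 0 / d))) := by
    have : Continuous (fun e : ℝ => ENNReal.ofReal (2 * e / d)) :=
      ENNReal.continuous_ofReal.comp (by fun_prop)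
    exact tendsto_nhdsWithin_of_tendsto_nhds ((this.add this).tendsto 0)
  simp only [mul_zero, zero_div, ENNReal.ofReal_zero, add_zero] at hlim
  refine le_antisymm (ge_of_tendsto hlim ?_) bot_le
  filter_upwards [Ioo_mem_nhdsGT hd0] with e he
  exact hbound e he.1 he.2

lemma unimodal_of_averages (ν : Measure (AddCircle (2 * π))) [IsFiniteMeasure ν] (φ ψ : ℝ)
    (h1 : ψ ≤ φ) (h2 : φ ≤ ψ + 2 * π)
    (hmono : ∀ u v w, ψ < u → u < v → v < w → w < φ →
      ν (toC '' Set.Ioo u v) ≤ ENNReal.ofReal ((v - u) / (w - v)) * ν (toC '' Set.Icc v w))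
    (hanti : ∀ u v w, φ < u → u < v → v < w → w < ψ + 2 * π →
      ν (toC '' Set.Ioo v w) ≤ ENNReal.ofReal ((w - v) / (v - u)) * ν (toC '' Set.Icc u v))
    (hatom : ψ < φ → φ < ψ + 2 * π → ν {toC ψ} = 0) : IsUnimodalCircle ν := by
  have hp := Real.pi_pos
  set σ : AddCircle (2 * π) → ℝ := fun y => (AddCircle.measurableEquivIoc (2 * π) ψ y : ℝ) with hσ
  have hσm : Measurable σ :=
    measurable_subtype_coe.comp (AddCircle.measurableEquivIoc (2 * π) ψ).measurable
  have hσI : ∀ y, σ y ∈ Set.Ioc ψ (ψ + 2 * π) := fun y =>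
    (AddCircle.measurableEquivIoc (2 * π) ψ y).2
  have hσl : ∀ y, toC (σ y) = y := fun y => AddCircle.coe_equivIoc
  have hσr : ∀ x ∈ Set.Ioc ψ (ψ + 2 * π), σ (toC x) = x := fun x hx =>
    AddCircle.equivIoc_coe_of_mem hx
  set l : Measure ℝ := ν.map σ with hl
  have hlS : ∀ S, MeasurableSet S → S ⊆ Set.Ioc ψ (ψ + 2 * π) → l S = ν (toC '' S) := by
    intro S hS hsub
    rw [hl, Measure.map_apply hσm hS]
    congr 1
    ext y
    constructor
    · intro hy; exact ⟨σ y, hy, hσl y⟩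
    · rintro ⟨x, hx, rfl⟩
      change σ (toC x) ∈ S
      rwa [hσr x (hsub hx)]
  have hlmap : l.map toC = ν := by
    rw [hl, Measure.map_map toC_meas hσm]
    have : toC ∘ σ = id := funext hσl
    rw [this, Measure.map_id]
  obtain ⟨f₁, hf₁0, hf₁m, hf₁⟩ := mono_density l ψ φ (by
    intro u v w hu huv hvw hw
    rw [hlS _ measurableSet_Ioo, hlS _ measurableSet_Icc]
    · exact hmono u v w hu huv hvw hw
    · intro x hx; exact ⟨by linarith [hx.1], by linarith [hx.2]⟩
    · intro x hx; exact ⟨by linarith [hx.1], by linarith [hx.2]⟩)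
  obtain ⟨f₂, hf₂0, hf₂m, hf₂⟩ := anti_density l φ (ψ + 2 * π) (by
    intro u v w hu huv hvw hw
    rw [hlS _ measurableSet_Ioo, hlS _ measurableSet_Icc]
    · exact hanti u v w hu huv hvw hw
    · intro x hx; exact ⟨by linarith [hx.1], by linarith [hx.2]⟩
    · intro x hx; exact ⟨by linarith [hx.1], by linarith [hx.2]⟩)
  set f : ℝ → ℝ := fun x => if x < φ then f₁ x else f₂ x with hf
  have hfl : ∀ x ∈ Set.Ioo ψ φ, f x = f₁ x := fun x hx => if_pos hx.2
  have hfr : ∀ x ∈ Set.Ioo φ (ψ + 2 * π), f x = f₂ x := fun x hx => if_neg (not_lt.2 hx.1.le)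
  refine ⟨φ, ψ, h1, h2, ν {toC φ}, f, ?_, ?_, ?_, ?_⟩
  · intro x
    simp only [hf]
    split_ifs
    exacts [hf₁0 x, hf₂0 x]
  · intro x hx y hy hxy
    rw [hfl x hx, hfl y hy]
    exact hf₁m hx hy hxy
  · intro x hx y hy hxy
    rw [hfr x hx, hfr y hy]
    exact hf₂m hx hy hxy
  set T : Set ℝ := Set.Ioo ψ φ ∪ Set.Ioo φ (ψ + 2 * π) with hT
  have hdisj : Disjoint (Set.Ioo ψ φ) (Set.Ioo φ (ψ + 2 * π)) := by
    rw [Set.disjoint_left]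
    intro x hx hx'
    exact lt_asymm hx.2 hx'.1
  have hTae : (Set.Ioo ψ (ψ + 2 * π) : Set ℝ) =ᵐ[volume] T := by
    have h0 : ∀ᵐ x : ℝ, x ≠ φ := by
      rw [ae_iff]; simp
    rw [Filter.eventuallyEq_set]
    filter_upwards [h0] with x hx
    constructor
    · rintro ⟨ha, hb⟩
      rcases lt_or_gt_of_ne hx with h | h
      · exact Or.inl ⟨ha, h⟩
      · exact Or.inr ⟨h, hb⟩
    · rintro (⟨ha, hb⟩ | ⟨ha, hb⟩)
      · exact ⟨ha, by linarith⟩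
      · exact ⟨by linarith, hb⟩
  have hW : (volume.restrict (Set.Ioo ψ (ψ + 2 * π))).withDensity (fun x => ENNReal.ofReal (f x)) =
      l.restrict T := by
    rw [Measure.restrict_congr_set hTae, hT, Measure.restrict_union hdisj measurableSet_Ioo,
      Measure.restrict_union hdisj measurableSet_Ioo, withDensity_add_measure, hf₁, hf₂]
    congr 1
    · apply withDensity_congr_ae
      filter_upwards [ae_restrict_mem measurableSet_Ioo] with x hx
      rw [hfl x hx]
    · apply withDensity_congr_ae
      filter_upwards [ae_restrict_mem measurableSet_Ioo] with x hx
      rw [hfr x hx]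
  rw [hW]
  set R : Set ℝ := toC ⁻¹' {toC φ} with hR
  have hRm : MeasurableSet R := toC_meas (measurableSet_singleton _)
  have hE : ∀ᵐ x ∂l, x = ψ + 2 * π → toC x = toC φ := by
    by_cases hA : φ = ψ
    · refine ae_of_all _ ?_
      rintro x rfl
      rw [toC_add_period, hA]
    by_cases hB : φ = ψ + 2 * π
    · refine ae_of_all _ ?_
      rintro x rfl
      rw [hB]
    have hz := hatom (lt_of_le_of_ne h1 (Ne.symm hA)) (lt_of_le_of_ne h2 hB)
    have : l {ψ + 2 * π} = 0 := by
      rw [hlS _ (measurableSet_singleton _) (by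
        rintro x rfl
        exact ⟨by linarith, le_rfl⟩), Set.image_singleton, toC_add_period, hz]
    have h0 : ∀ᵐ x ∂l, x ≠ ψ + 2 * π := by
      rw [ae_iff]; simpa using this
    filter_upwards [h0] with x hx hx'
    exact absurd hx' hx
  have hI : ∀ᵐ x ∂l, x ∈ Set.Ioc ψ (ψ + 2 * π) := by
    rw [hl]
    exact (ae_map_iff hσm.aemeasurable measurableSet_Ioc).2 (ae_of_all _ hσI)
  have hRT : (Rᶜ : Set ℝ) =ᵐ[l] T := by
    rw [Filter.eventuallyEq_set]
    filter_upwards [hE, hI] with x hxE hxI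
    constructor
    · intro hx
      have hx1 : x ≠ φ := by
        rintro rfl
        exact hx rfl
      have hx2 : x ≠ ψ + 2 * π := fun h => hx (hxE h)
      rcases lt_or_gt_of_ne hx1 with h | h
      · exact Or.inl ⟨hxI.1, h⟩
      · exact Or.inr ⟨h, lt_of_le_of_ne hxI.2 hx2⟩
    · intro hxT hxR
      have hxI' : ψ < x ∧ x < ψ + 2 * π ∧ x ≠ φ := by
        rcases hxT with ⟨ha, hb⟩ | ⟨ha, hb⟩
        · exact ⟨ha, by linarith, hb.ne⟩
        · exact ⟨by linarith, hb, ha.ne'⟩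
      exact hxI'.2.2 (toC_inj (by linarith [hxI'.2.1]) (by linarith [hxI'.1]) hxR)
  rw [← Measure.restrict_congr_set hRT, ← Measure.restrict_singleton]
  conv_lhs => rw [← hlmap, ← Measure.restrict_add_restrict_compl (μ := l) hRm,
    Measure.map_add _ _ toC_meas]
  congr 1
  rw [hR, ← Measure.restrict_map toC_meas (measurableSet_singleton _), hlmap]

theorem stmt_18 (μ : ℕ → Measure (AddCircle (2 * π))) (ν : Measure (AddCircle (2 * π)))
    (hP : ∀ n, IsProbabilityMeasure (μ n)) [IsProbabilityMeasure ν]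
    (hU : ∀ n, IsUnimodalCircle (μ n))
    (hw : ∀ g : BoundedContinuousFunction (AddCircle (2 * π)) ℝ,
      Tendsto (fun n => ∫ x, g x ∂(μ n)) atTop (nhds (∫ x, g x ∂ν))) :
    IsUnimodalCircle ν := by
  set ν' : ProbabilityMeasure (AddCircle (2 * π)) := ⟨ν, inferInstance⟩ with hν'
  set μ' : ℕ → ProbabilityMeasure (AddCircle (2 * π)) := fun n => ⟨μ n, hP n⟩ with hμ'
  have ht : Tendsto μ' atTop (nhds ν') :=
    ProbabilityMeasure.tendsto_iff_forall_integral_tendsto.2 hw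
  choose p hpK hp1 hp2 hpg using fun n => (hU n).good_norm
  obtain ⟨⟨φ, ψ⟩, -, s, hs, hlim⟩ := (isCompact_Icc.prod isCompact_Icc).tendsto_subseq hpK
  have ha : Tendsto (fun n => (p (s n)).1) atTop (nhds φ) := (continuous_fst.tendsto _).comp hlim
  have hb : Tendsto (fun n => (p (s n)).2) atTop (nhds ψ) := (continuous_snd.tendsto _).comp hlim
  have hts : Tendsto (fun n => μ' (s n)) atTop (nhds ν') := ht.comp hs.tendsto_atTop
  have hg : ∀ n, GoodCircle (μ' (s n) : Measure (AddCircle (2 * π))) (p (s n)).1 (p (s n)).2 :=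
    fun n => hpg (s n)
  apply unimodal_of_averages ν φ ψ
  · exact le_of_tendsto_of_tendsto' hb ha fun n => hp1 (s n)
  · exact le_of_tendsto_of_tendsto' ha (hb.add_const _) fun n => hp2 (s n)
  · intro u v w hu huv hvw hw
    refine limit_ineq hts (toC_open u v) (toC_closed v w) ENNReal.ofReal_ne_top ?_
    filter_upwards [hb.eventually_lt_const hu, ha.eventually_const_lt hw] with n h1 h2
    exact (hg n).mono u v w h1.le huv hvw h2
  · intro u v w hu huv hvw hw
    refine limit_ineq hts (toC_open v w) (toC_closed u v) ENNReal.ofReal_ne_top ?_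
    filter_upwards [ha.eventually_lt_const hu, (hb.add_const (2 * π)).eventually_const_lt hw]
      with n h1 h2
    exact (hg n).anti u v w h1 huv hvw h2.le
  · intro h1 h2
    exact limit_atom hts ha hb hg h1 h2
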